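/- Let σ ∈ (0,1], let μ be a σ-smooth Borel probability measure on [0,1]^2, let A be a monotone allocation region, let n ≥ 1 be an integer, ε = 1/n, and A_ε = φ_ε(A). Then ∫_{A_ε} |profit(A,v) − profit(A_ε,v)| dμ(v) ≤ 4ε/σ. -/

import Mathlib

open MeasureTheory Set
open scoped Classical

noncomputable section

/-- The unit square `[0,1]²` of valuation pairs. -/
def square : Set (ℝ × ℝ) := Set.Icc (0:ℝ) 1 ×ˢ Set.Icc (0:ℝ) 1

/-- A (bilateral-trade) monotone allocation region: a closed subset of the unit square,
closed in the north-west direction. -/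
def IsAllocRegion (A : Set (ℝ × ℝ)) : Prop :=
  IsClosed A ∧ A ⊆ square ∧
    ∀ x ∈ A, ∀ y ∈ square, y.1 ≤ x.1 → x.2 ≤ y.2 → y ∈ A

/-- Myerson seller payment `p_A`. -/
def sellerPay (A : Set (ℝ × ℝ)) (v : ℝ × ℝ) : ℝ :=
  if v ∈ A then sSup {x : ℝ | x ∈ Set.Icc (0:ℝ) 1 ∧ (x, v.2) ∈ A} else 0

/-- Myerson buyer payment `q_A`. -/
def buyerPay (A : Set (ℝ × ℝ)) (v : ℝ × ℝ) : ℝ :=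
  if v ∈ A then sInf {y : ℝ | y ∈ Set.Icc (0:ℝ) 1 ∧ (v.1, y) ∈ A} else 0

/-- The broker's profit. -/
def profit (A : Set (ℝ × ℝ)) (v : ℝ × ℝ) : ℝ :=
  buyerPay A v - sellerPay A v

/-- The closed `ε`-tile with lower-left corner `(k/n, j/n)`, where `ε = 1/n`. -/
def tile (n k j : ℕ) : Set (ℝ × ℝ) :=
  Set.Icc ((k : ℝ) / n) (((k : ℝ) + 1) / n) ×ˢ Set.Icc ((j : ℝ) / n) (((j : ℝ) + 1) / n)

/-- The `ε`-approximation `φ_ε(A)`: the union of all `ε`-tiles contained in `A`. -/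
def gridApprox (n : ℕ) (A : Set (ℝ × ℝ)) : Set (ℝ × ℝ) :=
  ⋃ (k : Fin n) (j : Fin n) (_ : tile n k j ⊆ A), tile n k j

end

/-- The upper boundary of `A` in the first coordinate, extended to a monotone function on `ℝ`. -/
noncomputable def sellerBoundary (A : Set (ℝ × ℝ)) (y : ℝ) : ℝ :=
  sSup {x : ℝ | x ∈ Set.Icc (0:ℝ) 1 ∧ (x, min y 1) ∈ A}

/-- The lower boundary of `A` in the second coordinate, extended to a monotone function on `ℝ`. -/
noncomputable def buyerBoundary (A : Set (ℝ × ℝ)) (x : ℝ) : ℝ :=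
  sInf (insert 1 {y : ℝ | y ∈ Set.Icc (0:ℝ) 1 ∧ (max x 0, y) ∈ A})

lemma sellerBoundary_mem_Icc (A : Set (ℝ × ℝ)) (y : ℝ) :
    sellerBoundary A y ∈ Set.Icc (0:ℝ) 1 :=
  ⟨Real.sSup_nonneg fun _ hx => hx.1.1, Real.sSup_le (fun _ hx => hx.1.2) zero_le_one⟩

lemma buyerBoundary_mem_Icc (A : Set (ℝ × ℝ)) (x : ℝ) :
    buyerBoundary A x ∈ Set.Icc (0:ℝ) 1 := by
  have h0 : ∀ y ∈ insert 1 {y : ℝ | y ∈ Set.Icc (0:ℝ) 1 ∧ (max x 0, y) ∈ A}, (0:ℝ) ≤ y := by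
    rintro y (rfl | hy)
    · exact zero_le_one
    · exact hy.1.1
  exact ⟨Real.sInf_nonneg h0, csInf_le ⟨0, h0⟩ (mem_insert _ _)⟩

lemma monotone_sellerBoundary {A : Set (ℝ × ℝ)} (hA : IsAllocRegion A) :
    Monotone (sellerBoundary A) := by
  intro y z hyz
  refine Real.sSup_le (fun x hx => ?_) (sellerBoundary_mem_Icc A z).1
  have hle : min y 1 ≤ min z 1 := min_le_min_right _ hyz
  exact le_csSup ⟨1, fun _ h => h.1.2⟩
    ⟨hx.1, hA.2.2 _ hx.2 _ ⟨hx.1, (hA.2.1 hx.2).2.1.trans hle, min_le_right _ _⟩ le_rfl hle⟩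

lemma monotone_buyerBoundary {A : Set (ℝ × ℝ)} (hA : IsAllocRegion A) :
    Monotone (buyerBoundary A) := by
  intro x z hxz
  refine le_csInf (insert_nonempty _ _) ?_
  rintro y (rfl | hy)
  · exact (buyerBoundary_mem_Icc A x).2
  have hle : max x 0 ≤ max z 0 := max_le_max_right _ hxz
  refine csInf_le ⟨0, ?_⟩ (Or.inr ⟨hy.1, hA.2.2 _ hy.2 _
    ⟨⟨le_max_right _ _, hle.trans (hA.2.1 hy.2).1.2⟩, hy.1⟩ hle le_rfl⟩)
  rintro w (rfl | hw)
  · exact zero_le_one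
  · exact hw.1.1

lemma gridApprox_subset (n : ℕ) (A : Set (ℝ × ℝ)) : gridApprox n A ⊆ A :=
  iUnion_subset fun _ => iUnion_subset fun _ => iUnion_subset fun h => h

lemma mem_gridApprox {n : ℕ} {A : Set (ℝ × ℝ)} {v : ℝ × ℝ} :
    v ∈ gridApprox n A ↔ ∃ k < n, ∃ j < n, tile n k j ⊆ A ∧ v ∈ tile n k j := by
  simp only [gridApprox, mem_iUnion, exists_prop]
  constructor
  · rintro ⟨k, j, h⟩
    exact ⟨k, k.2, j, j.2, h⟩
  · rintro ⟨k, hk, j, hj, h⟩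
    exact ⟨⟨k, hk⟩, ⟨j, hj⟩, h⟩

lemma measurableSet_gridApprox (n : ℕ) (A : Set (ℝ × ℝ)) : MeasurableSet (gridApprox n A) :=
  MeasurableSet.iUnion fun _ => MeasurableSet.iUnion fun _ => MeasurableSet.iUnion fun _ =>
    measurableSet_Icc.prod measurableSet_Icc

/-- A tile is contained in a monotone region as soon as the region contains a point to the
south-east of the tile. -/
lemma tile_subset_of_mem {A : Set (ℝ × ℝ)} (hA : IsAllocRegion A) {n k j : ℕ} (hk : k < n)
    (hj : j < n) {x : ℝ × ℝ} (hx : x ∈ A) (h1 : ((k : ℝ) + 1) / n ≤ x.1) (h2 : x.2 ≤ (j : ℝ) / n) :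
    tile n k j ⊆ A := by
  have hn : (0:ℝ) < n := by exact_mod_cast (Nat.zero_le k).trans_lt hk
  have hj' : ((j : ℝ) + 1) / n ≤ 1 := (div_le_one hn).2 (by exact_mod_cast hj)
  rintro ⟨a, b⟩ ⟨⟨ha, ha'⟩, hb, hb'⟩
  dsimp only at ha ha' hb hb'
  exact hA.2.2 x hx _ ⟨⟨le_trans (by positivity) ha, ha'.trans (h1.trans (hA.2.1 hx).1.2)⟩,
    le_trans (by positivity) hb, hb'.trans hj'⟩ (ha'.trans h1) (h2.trans hb)

lemma sellerPay_of_mem {A : Set (ℝ × ℝ)} (hA : A ⊆ square) {v : ℝ × ℝ} (hv : v ∈ A) :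
    sellerPay A v = sellerBoundary A v.2 := by
  rw [sellerPay, if_pos hv, sellerBoundary, min_eq_left (hA hv).2.2]

lemma buyerPay_of_mem {A : Set (ℝ × ℝ)} (hA : A ⊆ square) {v : ℝ × ℝ} (hv : v ∈ A) :
    buyerPay A v = buyerBoundary A v.1 := by
  have hbdd : BddBelow {y : ℝ | y ∈ Set.Icc (0:ℝ) 1 ∧ (v.1, y) ∈ A} := ⟨0, fun _ h => h.1.1⟩
  have hmem : v.2 ∈ {y : ℝ | y ∈ Set.Icc (0:ℝ) 1 ∧ (v.1, y) ∈ A} := ⟨(hA hv).2, hv⟩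
  rw [buyerPay, if_pos hv, buyerBoundary, max_eq_left (hA hv).1.1, csInf_insert hbdd ⟨_, hmem⟩]
  exact (min_eq_right ((csInf_le hbdd hmem).trans (hA hv).2.2)).symm

lemma sellerBoundary_sub_le {A : Set (ℝ × ℝ)} (hA : IsAllocRegion A) {n : ℕ} {v : ℝ × ℝ}
    (hv : v ∈ gridApprox n A) :
    sellerBoundary A (v.2 - 1 / n) - 1 / n ≤ sellerBoundary (gridApprox n A) v.2 := by
  obtain ⟨k, hk, j, hj, -, hvt⟩ := mem_gridApprox.1 hv
  have hn : (0:ℝ) < n := by exact_mod_cast (Nat.zero_le k).trans_lt hk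
  have hnn := (sellerBoundary_mem_Icc (gridApprox n A) v.2).1
  have hsq := hA.2.1 (gridApprox_subset n A hv)
  have hvj : v.2 - 1 / n ≤ (j : ℝ) / n := by
    have := hvt.2.2
    rw [add_div] at this
    linarith
  rw [sub_le_iff_le_add]
  refine Real.sSup_le (fun x hx => ?_) (by positivity)
  rw [← sub_le_iff_le_add]
  rcases le_or_gt x (1 / n) with hxn | hxn
  · linarith
  have hpos : 1 ≤ (n : ℝ) * x := by
    rw [div_lt_iff₀ hn] at hxn
    linarith
  obtain ⟨m, hm⟩ : ∃ m, ⌊(n : ℝ) * x⌋₊ = m + 1 :=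
    Nat.exists_eq_add_one.2 (Nat.floor_pos.2 hpos)
  have hle : (m : ℝ) + 1 ≤ n * x := by
    exact_mod_cast hm ▸ Nat.floor_le (zero_le_one.trans hpos)
  have hlt : (n : ℝ) * x < m + 1 + 1 := by
    exact_mod_cast hm ▸ Nat.lt_floor_add_one ((n : ℝ) * x)
  have hmx : ((m : ℝ) + 1) / n ≤ x := (div_le_iff₀ hn).2 (by linarith)
  have hmn : m < n := by
    have : (m : ℝ) + 1 ≤ n := hle.trans (mul_le_of_le_one_right hn.le hx.1.2)
    exact_mod_cast this
  have hsub := tile_subset_of_mem hA hmn hj hx.2 hmx ((min_le_left _ _).trans hvj)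
  have hmem : (((m : ℝ) + 1) / n, min v.2 1) ∈ gridApprox n A := by
    refine mem_gridApprox.2 ⟨m, hmn, j, hj, hsub, ⟨?_, le_rfl⟩, ?_⟩
    · exact div_le_div_of_nonneg_right (by linarith) hn.le
    · rw [min_eq_left hsq.2.2]
      exact hvt.2
  have hlast : ((m : ℝ) + 1) / n ≤ sellerBoundary (gridApprox n A) v.2 :=
    le_csSup ⟨1, fun _ h => h.1.2⟩ ⟨⟨by positivity, hmx.trans hx.1.2⟩, hmem⟩
  refine le_trans ?_ hlast
  rw [sub_le_iff_le_add, ← add_div, le_div_iff₀ hn]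
  linarith

lemma buyerBoundary_le_add {A : Set (ℝ × ℝ)} (hA : IsAllocRegion A) {n : ℕ} {v : ℝ × ℝ}
    (hv : v ∈ gridApprox n A) :
    buyerBoundary (gridApprox n A) v.1 ≤ buyerBoundary A (v.1 + 1 / n) + 1 / n := by
  obtain ⟨k, hk, j, hj, -, hvt⟩ := mem_gridApprox.1 hv
  have hn : (0:ℝ) < n := by exact_mod_cast (Nat.zero_le k).trans_lt hk
  have hle1 := (buyerBoundary_mem_Icc (gridApprox n A) v.1).2
  have hsq := hA.2.1 (gridApprox_subset n A hv)
  have hinv : (0:ℝ) < 1 / n := by positivity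
  have hvk : ((k : ℝ) + 1) / n ≤ v.1 + 1 / n := by
    have := hvt.1.1
    rw [add_div]
    linarith
  rw [← sub_le_iff_le_add]
  refine le_csInf (insert_nonempty _ _) ?_
  rintro y (rfl | hy)
  · linarith
  rw [sub_le_iff_le_add]
  have hy0 := hy.1.1
  have hge := Nat.le_ceil ((n : ℝ) * y)
  have hlt := Nat.ceil_lt_add_one (mul_nonneg hn.le hy0)
  generalize ⌈(n : ℝ) * y⌉₊ = m at hge hlt
  have hmy : (m : ℝ) / n ≤ y + 1 / n := by
    rw [div_le_iff₀ hn, add_mul, div_mul_cancel₀ _ hn.ne']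
    linarith
  refine le_trans ?_ hmy
  rcases le_or_gt n m with hmn | hmn
  · exact hle1.trans ((one_le_div hn).2 (by exact_mod_cast hmn))
  have hsub := tile_subset_of_mem hA hk hmn hy.2 (hvk.trans (le_max_left _ _))
    ((le_div_iff₀ hn).2 (by linarith))
  refine csInf_le ⟨0, ?_⟩ (Or.inr ⟨⟨by positivity,
    (div_le_one hn).2 (by exact_mod_cast hmn.le)⟩, ?_⟩)
  · rintro w (rfl | hw)
    · exact zero_le_one
    · exact hw.1.1
  · refine mem_gridApprox.2 ⟨k, hk, m, hmn, hsub, ?_, le_rfl, ?_⟩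
    · rw [max_eq_left hsq.1.1]
      exact hvt.1
    · exact div_le_div_of_nonneg_right (by linarith) hn.le

/-- The loss of profit from replacing `A` by its grid approximation is controlled by increments
of the boundary functions of `A`. -/
lemma abs_profit_sub_profit_gridApprox_le {A : Set (ℝ × ℝ)} (hA : IsAllocRegion A) {n : ℕ}
    {v : ℝ × ℝ} (hv : v ∈ gridApprox n A) :
    |profit A v - profit (gridApprox n A) v| ≤
      (buyerBoundary A (v.1 + 1 / n) - buyerBoundary A v.1 + 1 / n) +
        (sellerBoundary A v.2 - sellerBoundary A (v.2 - 1 / n) + 1 / n) := by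
  have hsub := gridApprox_subset n A
  have hs := sellerBoundary_sub_le hA hv
  have hb := buyerBoundary_le_add hA hv
  have hs' : sellerBoundary (gridApprox n A) v.2 ≤ sellerBoundary A v.2 :=
    Real.sSup_le (fun x hx => le_csSup ⟨1, fun _ h => h.1.2⟩ ⟨hx.1, hsub hx.2⟩)
      (sellerBoundary_mem_Icc A _).1
  have hb' : buyerBoundary A v.1 ≤ buyerBoundary (gridApprox n A) v.1 := by
    refine csInf_le_csInf ⟨0, ?_⟩ (insert_nonempty _ _)
      (insert_subset_insert fun y hy => ⟨hy.1, hsub hy.2⟩)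
    rintro w (rfl | hw)
    · exact zero_le_one
    · exact hw.1.1
  rw [profit, profit, sellerPay_of_mem hA.2.1 (hsub hv), buyerPay_of_mem hA.2.1 (hsub hv),
    sellerPay_of_mem (hsub.trans hA.2.1) hv, buyerPay_of_mem (hsub.trans hA.2.1) hv, abs_le]
  constructor <;> linarith

/-- The increments over steps of length `ε` of a monotone function with values in `[0, 1]`
have total mass at most `ε`. -/
lemma integral_add_sub_le {f : ℝ → ℝ} (hf : Monotone f) (h01 : ∀ x, f x ∈ Set.Icc (0:ℝ) 1)
    {ε : ℝ} (hε : 0 ≤ ε) (a b : ℝ) :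
    ∫ x in a..b, (f (x + ε) - f x) ≤ ε := by
  have hi : ∀ c d, IntervalIntegrable f volume c d := fun _ _ => hf.intervalIntegrable
  have hi' : IntervalIntegrable (fun x => f (x + ε)) volume a b :=
    (hf.comp (fun _ _ h => by simpa using h : Monotone (fun x => x + ε))).intervalIntegrable
  rw [intervalIntegral.integral_sub hi' (hi _ _), intervalIntegral.integral_comp_add_right,
    intervalIntegral.integral_interval_sub_interval_comm (hi _ _) (hi _ _) (hi _ _)]
  have h1 : 0 ≤ ∫ x in a..a + ε, f x :=
    intervalIntegral.integral_nonneg (by linarith) fun x _ => (h01 x).1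
  have h2 : ∫ x in b..b + ε, f x ≤ ∫ _ in b..b + ε, (1:ℝ) :=
    intervalIntegral.integral_mono_on (by linarith) (hi _ _) (by simp) fun x _ => (h01 x).2
  rw [intervalIntegral.integral_symm a, intervalIntegral.integral_symm b]
  simp at h2
  linarith

/-- The integral of a sum of univariate functions over the unit square. -/
lemma setIntegral_square_add {f g : ℝ → ℝ} (hf : IntegrableOn f (Set.Icc 0 1))
    (hg : IntegrableOn g (Set.Icc 0 1)) :
    IntegrableOn (fun v : ℝ × ℝ => f v.1 + g v.2) square ∧
      ∫ v in square, (f v.1 + g v.2) = (∫ x in (0:ℝ)..1, f x) + ∫ y in (0:ℝ)..1, g y := by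
  have hprod : (volume : Measure (ℝ × ℝ)).restrict square =
      (volume.restrict (Set.Icc (0:ℝ) 1)).prod (volume.restrict (Set.Icc (0:ℝ) 1)) := by
    rw [Measure.prod_restrict, square, Measure.volume_eq_prod]
  have hf' := Integrable.comp_fst hf (volume.restrict (Set.Icc (0:ℝ) 1))
  have hg' := Integrable.comp_snd hg (volume.restrict (Set.Icc (0:ℝ) 1))
  rw [IntegrableOn, hprod]
  refine ⟨hf'.add hg', ?_⟩
  rw [integral_add hf' hg', integral_fun_fst, integral_fun_snd]
  simp [integral_Icc_eq_integral_Ioc, intervalIntegral.integral_of_le]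

lemma smooth_le_smul_restrict_square {σ : ℝ} {μ : Measure (ℝ × ℝ)} (hsupp : μ squareᶜ = 0)
    (hsmooth : ∀ E ⊆ square, MeasurableSet E → μ E ≤ volume E / ENNReal.ofReal σ) :
    μ ≤ (ENNReal.ofReal σ)⁻¹ • volume.restrict square := by
  refine Measure.le_iff.2 fun E hE => ?_
  have hsq : MeasurableSet square := measurableSet_Icc.prod measurableSet_Icc
  have h := hsmooth (E ∩ square) inter_subset_right (hE.inter hsq)
  rw [Measure.smul_apply, Measure.restrict_apply hE, smul_eq_mul, mul_comm, ← div_eq_mul_inv]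
  rwa [measure_inter_conull hsupp] at h

/-- the part of the `L¹` approximation error supported inside the grid
approximation `A_eps` is at most `4*eps/sigma`. -/
theorem l1_net_inside (σ : ℝ) (hσ : σ ∈ Set.Ioc (0:ℝ) 1)
    (μ : MeasureTheory.Measure (ℝ × ℝ)) [MeasureTheory.IsProbabilityMeasure μ]
    (hsupp : μ squareᶜ = 0)
    (hsmooth : ∀ E ⊆ square, MeasurableSet E →
      μ E ≤ MeasureTheory.volume E / ENNReal.ofReal σ)
    (A : Set (ℝ × ℝ)) (hA : IsAllocRegion A)
    (n : ℕ) (hn : 1 ≤ n) :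
    ∫ v in gridApprox n A, |profit A v - profit (gridApprox n A) v| ∂μ
      ≤ 4 * (1 / (n : ℝ)) / σ := by
  have hn0 : (0:ℝ) < n := by exact_mod_cast hn
  have hε : (0:ℝ) ≤ 1 / n := by positivity
  have hmb := monotone_buyerBoundary hA
  have hms := monotone_sellerBoundary hA
  set F : ℝ → ℝ := fun x => buyerBoundary A (x + 1 / n) - buyerBoundary A x + 1 / n with hF
  set G : ℝ → ℝ := fun y => sellerBoundary A y - sellerBoundary A (y - 1 / n) + 1 / n with hG
  have hF0 : ∀ x, 0 ≤ F x := fun x => by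
    have := hmb (show x ≤ x + 1 / (n : ℝ) by linarith)
    simp only [hF]
    linarith
  have hG0 : ∀ y, 0 ≤ G y := fun y => by
    have := hms (show y - 1 / (n : ℝ) ≤ y by linarith)
    simp only [hG]
    linarith
  have hms' : Monotone fun y => sellerBoundary A (y - 1 / n) :=
    fun y z h => hms (by linarith)
  have hmb' : Monotone fun x => buyerBoundary A (x + 1 / n) :=
    fun y z h => hmb (by linarith)
  have hint : ∀ {f g : ℝ → ℝ}, Monotone f → Monotone g →
      IntegrableOn (fun x => f x - g x) (Set.Icc 0 1) := fun hf hg =>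
    ((hf.monotoneOn _).integrableOn_isCompact isCompact_Icc).sub
      ((hg.monotoneOn _).integrableOn_isCompact isCompact_Icc)
  have hii : ∀ {f : ℝ → ℝ}, IntegrableOn f (Set.Icc 0 1) → IntervalIntegrable f volume 0 1 :=
    fun hf => (intervalIntegrable_iff_integrableOn_Icc_of_le zero_le_one).2 hf
  have hFi : IntegrableOn F (Set.Icc 0 1) :=
    (hint hmb' hmb).add (integrableOn_const (by simp))
  have hGi : IntegrableOn G (Set.Icc 0 1) :=
    (hint hms hms').add (integrableOn_const (by simp))
  have hFle : ∫ x in (0:ℝ)..1, F x ≤ 2 * (1 / n) := by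
    have h := integral_add_sub_le hmb (buyerBoundary_mem_Icc A) hε 0 1
    rw [hF, intervalIntegral.integral_add (hii (hint hmb' hmb)) (by simp)]
    simp only [intervalIntegral.integral_const, sub_zero, one_smul]
    linarith
  have hGle : ∫ y in (0:ℝ)..1, G y ≤ 2 * (1 / n) := by
    have h := integral_add_sub_le hms' (fun y => sellerBoundary_mem_Icc A _) hε 0 1
    simp only [add_sub_cancel_right] at h
    rw [hG, intervalIntegral.integral_add (hii (hint hms hms')) (by simp)]
    simp only [intervalIntegral.integral_const, sub_zero, one_smul]
    linarith
  obtain ⟨hHi, hHeq⟩ := setIntegral_square_add hFi hGi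
  have hμ := smooth_le_smul_restrict_square hsupp hsmooth
  have hHi' : Integrable (fun v : ℝ × ℝ => F v.1 + G v.2)
      ((ENNReal.ofReal σ)⁻¹ • volume.restrict square) :=
    hHi.smul_measure (ENNReal.inv_ne_top.2 (ENNReal.ofReal_pos.2 hσ.1).ne')
  have hH0 : ∀ v : ℝ × ℝ, 0 ≤ F v.1 + G v.2 := fun v => add_nonneg (hF0 _) (hG0 _)
  calc ∫ v in gridApprox n A, |profit A v - profit (gridApprox n A) v| ∂μ
      ≤ ∫ v in gridApprox n A, (F v.1 + G v.2) ∂μ :=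
        integral_mono_of_nonneg (ae_of_all _ fun _ => abs_nonneg _)
          (hHi'.mono_measure hμ).integrableOn
          (ae_restrict_of_forall_mem (measurableSet_gridApprox n A) fun v hv =>
            abs_profit_sub_profit_gridApprox_le hA hv)
    _ ≤ ∫ v, (F v.1 + G v.2) ∂((ENNReal.ofReal σ)⁻¹ • volume.restrict square) :=
        integral_mono_measure (Measure.restrict_le_self.trans hμ) (ae_of_all _ hH0) hHi'
    _ = σ⁻¹ * ((∫ x in (0:ℝ)..1, F x) + ∫ y in (0:ℝ)..1, G y) := by
        rw [integral_smul_measure, hHeq, ENNReal.toReal_inv, ENNReal.toReal_ofReal hσ.1.le,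
          smul_eq_mul]
    _ ≤ 4 * (1 / (n : ℝ)) / σ := by
        rw [div_eq_inv_mul]
        exact mul_le_mul_of_nonneg_left (by linarith) (inv_nonneg.2 hσ.1.le)
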